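/- The Jacobian of the wheel graph W(n) is isomorphic to coker(𝒜ⁿ − I₂), where 𝒜 is the 2×2 integer matrix [[0,1],[−1,3]]. -/

import Mathlib

open SimpleGraph

/-- The cone over a graph `G`. -/
def cone {V : Type*} (G : SimpleGraph V) : SimpleGraph (Option V) :=
  SimpleGraph.fromRel (fun x y => x = none ∨ ∃ a b, x = some a ∧ y = some b ∧ G.Adj a b)

/-- The wheel graph `W(n)`: the cone over the cycle graph `Cₙ`. -/
def wheel (n : ℕ) : SimpleGraph (Option (Fin n)) := cone (cycleGraph n)

open scoped Classical in
/-- The Laplacian matrix of `G` with integer entries. -/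
noncomputable def lap {V : Type*} [Fintype V] (G : SimpleGraph V) : Matrix V V ℤ :=
  G.lapMatrix ℤ

open scoped Classical in
/-- The cokernel `ℤ^α / im M` of an integer matrix `M`. -/
noncomputable abbrev coker {α : Type*} [Fintype α] (M : Matrix α α ℤ) :=
  (α → ℤ) ⧸ LinearMap.range (Matrix.toLin' M)

open scoped Classical in
/-- The Jacobian (critical group) of a graph. -/
noncomputable def jac {V : Type*} [Fintype V] (G : SimpleGraph V) :=
  Submodule.torsion ℤ (coker (lap G))

section helpers
open scoped Fin.CommRing

lemma coker_mk_mulVec {α : Type*} [Fintype α] (M : Matrix α α ℤ) (y : α → ℤ) :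
    (Submodule.Quotient.mk (M.mulVec y) : coker M) = 0 := by
  classical
  rw [Submodule.Quotient.mk_eq_zero]
  exact ⟨y, by rw [Matrix.toLin'_apply]⟩

lemma coker_mk_eq_zero {α : Type*} [Fintype α] (M : Matrix α α ℤ) (x : α → ℤ)
    (h : (Submodule.Quotient.mk x : coker M) = 0) : ∃ y, M.mulVec y = x := by
  classical
  rw [Submodule.Quotient.mk_eq_zero] at h
  obtain ⟨y, hy⟩ := h
  exact ⟨y, by rw [← hy, Matrix.toLin'_apply]⟩

open scoped Classical in
lemma coker_le_ker {α N : Type*} [Fintype α] [AddCommGroup N] (M : Matrix α α ℤ)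
    (f : (α → ℤ) →ₗ[ℤ] N) (h : ∀ y, f (M.mulVec y) = 0) :
    LinearMap.range (Matrix.toLin' M) ≤ LinearMap.ker f := by
  rintro _ ⟨y, rfl⟩
  rw [LinearMap.mem_ker, Matrix.toLin'_apply, h]

lemma lap_symm {V : Type*} [Fintype V] (G : SimpleGraph V) : (lap G).transpose = lap G := by
  classical
  exact SimpleGraph.isSymm_lapMatrix ℤ G

lemma lap_const {V : Type*} [Fintype V] (G : SimpleGraph V) :
    (lap G).mulVec (fun _ => 1) = 0 := by
  classical
  exact SimpleGraph.lapMatrix_mulVec_const_eq_zero G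

open scoped Classical in
lemma lap_entry {V : Type*} [Fintype V] (G : SimpleGraph V) (i k : V) :
    lap G i k = (if i = k then (G.degree i : ℤ) else 0) - (if G.Adj i k then 1 else 0) := by
  unfold lap
  rw [SimpleGraph.lapMatrix, Matrix.sub_apply, SimpleGraph.adjMatrix_apply,
    SimpleGraph.degMatrix, Matrix.diagonal_apply]

lemma lap_sum {V : Type*} [Fintype V] (G : SimpleGraph V) (x : V → ℤ) :
    ∑ i, (lap G).mulVec x i = 0 := by
  classical
  have h1 : (lap G).mulVec (fun _ => 1) = 0 := SimpleGraph.lapMatrix_mulVec_const_eq_zero G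
  have h2 : (lap G).transpose = lap G := SimpleGraph.isSymm_lapMatrix ℤ G
  have h3 : ∑ i, (lap G).mulVec x i = (fun _ => (1:ℤ)) ⬝ᵥ (lap G).mulVec x := by
    simp [dotProduct]
  rw [h3, Matrix.dotProduct_mulVec, ← Matrix.mulVec_transpose, h2, h1, zero_dotProduct]

lemma wheel_adj_some (m : ℕ) (i : Fin (m+3)) (k : Option (Fin (m+3))) :
    (wheel (m+3)).Adj (some i) k ↔ (k = none ∨ k = some (i+1) ∨ k = some (i-1)) := by
  have h := fun j => SimpleGraph.cycleGraph_adj (n := m+1) (u := i) (v := j)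
  have h' := fun j => SimpleGraph.cycleGraph_adj (n := m+1) (u := j) (v := i)
  cases k with
  | none => simp [wheel, cone, SimpleGraph.fromRel_adj]
  | some j =>
    have e1 : (j - i = 1) ↔ (j = i + 1) := by rw [sub_eq_iff_eq_add, add_comm 1 i]
    have e2 : (i - j = 1) ↔ (j = i - 1) := by
      constructor
      · intro h; rw [← h]; abel
      · intro h; rw [h]; abel
    have e3 : (cycleGraph (m+3)).Adj i j → i ≠ j := fun h => h.ne
    have key : (wheel (m+3)).Adj (some i) (some j) ↔ (cycleGraph (m+3)).Adj i j := by
      simp only [wheel, cone, SimpleGraph.fromRel_adj]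
      constructor
      · rintro ⟨_, (h | ⟨a, b, ha, hb, hab⟩) | (h | ⟨a, b, ha, hb, hab⟩)⟩
        · simp at h
        · cases ha; cases hb; exact hab
        · simp at h
        · cases ha; cases hb; exact hab.symm
      · intro h
        exact ⟨by simpa using h.ne, Or.inl (Or.inr ⟨i, j, rfl, rfl, h⟩)⟩
    rw [key, h j, e1, e2]
    simp [or_comm]

lemma wheel_col (m : ℕ) (i : Fin (m+3)) :
    (lap (wheel (m+3))).mulVec (Pi.single (some i) 1) =
      3 • Pi.single (some i) 1 - Pi.single (some (i+1)) 1 - Pi.single (some (i-1)) 1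
        - Pi.single none 1 := by
  classical
  have hne1 : i + 1 ≠ i - 1 := by
    intro h
    have h2 : (1 : Fin (m+3)) + 1 = 0 := by
      have : (i + 1) - (i - 1) = 0 := by rw [h]; simp
      rw [← this]; abel
    have := congrArg Fin.val h2
    simp [Fin.val_add] at this
    rw [Nat.mod_eq_of_lt (by omega)] at this
    omega
  have hN : (wheel (m+3)).neighborFinset (some i) = {none, some (i+1), some (i-1)} := by
    ext k
    rw [SimpleGraph.mem_neighborFinset, wheel_adj_some]
    simp
  have hdeg : (wheel (m+3)).degree (some i) = 3 := by
    rw [← SimpleGraph.card_neighborFinset_eq_degree, hN, Finset.card_insert_of_notMem (by simp),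
      Finset.card_pair (by simpa using hne1)]
  have hs : (lap (wheel (m+3))).transpose = lap (wheel (m+3)) :=
    lap_symm _
  have hrow : ∀ k, lap (wheel (m+3)) (some i) k =
      (if some i = k then 3 else 0) - (if (k = none ∨ k = some (i+1) ∨ k = some (i-1)) then 1 else 0) := by
    intro k
    have : lap (wheel (m+3)) (some i) k = (if some i = k then ((wheel (m+3)).degree (some i) : ℤ) else 0)
      - (if (wheel (m+3)).Adj (some i) k then 1 else 0) := by
      rw [lap_entry]
      congr!
    rw [this, hdeg]
    simp only [wheel_adj_some]
    rfl
  ext k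
  rw [Matrix.mulVec_single_one, ← hs]
  change lap (wheel (m+3)) (some i) k = _
  rw [hrow]
  cases k with
  | none => simp
  | some j =>
    simp only [Pi.sub_apply, Pi.smul_apply, Pi.single_apply, Option.some.injEq, reduceCtorEq,
      false_or, if_false]
    by_cases h1 : j = i + 1
    · have : j ≠ i - 1 := by rw [h1]; exact hne1
      subst h1; simp [hne1]
    · by_cases h2 : j = i - 1
      · subst h2; simp [hne1.symm, eq_comm (a := i) (b := i - 1)]
      · simp [h1, h2, eq_comm (a := j) (b := i)]

abbrev matA : Matrix (Fin 2) (Fin 2) ℤ := !![0, 1; -1, 3]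

abbrev vecV : Fin 2 → ℤ := ![1, 0]

lemma matA_sq : matA ^ 2 = 3 • matA - 1 := by
  rw [pow_two]; decide

lemma matA_pow_form (k : ℕ) : ∃ a b : ℤ, matA ^ (k+1) = !![a, b; -b, a + 3*b] ∧
    a * (a + 3*b) + b*b = 1 ∧ 1 ≤ b ∧ 1 ≤ a + b := by
  induction k with
  | zero => exact ⟨0, 1, by simp [matA], by norm_num, by norm_num, by norm_num⟩
  | succ k ih =>
    obtain ⟨a, b, h, hd, h1, h2⟩ := ih
    refine ⟨-b, a + 3*b, ?_, ?_, by linarith, by linarith⟩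
    · rw [pow_succ', h, matA, Matrix.mul_fin_two]
      congr! 3 <;> ring_nf
    · linarith

lemma matA_det (k : ℕ) : (matA ^ (k+1) - 1).det ≠ 0 := by
  obtain ⟨a, b, h, hd, h1, h2⟩ := matA_pow_form k
  rw [h, Matrix.det_fin_two]
  simp
  intro h
  nlinarith

lemma mk_add_n (n k : ℕ) :
    (Submodule.Quotient.mk ((matA ^ (k + n)).mulVec vecV) : coker (matA ^ n - 1)) =
      Submodule.Quotient.mk ((matA ^ k).mulVec vecV) := by
  rw [← sub_eq_zero, ← Submodule.Quotient.mk_sub]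
  have : (matA ^ (k + n)).mulVec vecV - (matA ^ k).mulVec vecV =
      (matA ^ n - 1).mulVec ((matA ^ k).mulVec vecV) := by
    rw [Matrix.mulVec_mulVec, ← Matrix.sub_mulVec, sub_mul, one_mul, ← pow_add, add_comm]
  rw [this, coker_mk_mulVec]

lemma mk_mod (n k : ℕ) :
    (Submodule.Quotient.mk ((matA ^ (k % n)).mulVec vecV) : coker (matA ^ n - 1)) =
      Submodule.Quotient.mk ((matA ^ k).mulVec vecV) := by
  have : ∀ q r : ℕ, (Submodule.Quotient.mk ((matA ^ (r + n * q)).mulVec vecV) :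
      coker (matA ^ n - 1)) = Submodule.Quotient.mk ((matA ^ r).mulVec vecV) := by
    intro q r
    induction q with
    | zero => simp
    | succ q ih => rw [mul_add, mul_one, ← add_assoc, mk_add_n, ih]
  conv_rhs => rw [← Nat.mod_add_div k n]
  rw [this]

/-- The vector map sending `e_i` to `A^i v`. -/
noncomputable def gmap (n : ℕ) : (Option (Fin n) → ℤ) →ₗ[ℤ] coker (matA ^ n - 1) :=
  ∑ i : Fin n, (LinearMap.proj (some i) : (Option (Fin n) → ℤ) →ₗ[ℤ] ℤ).smulRight
    (Submodule.Quotient.mk ((matA ^ (i : ℕ)).mulVec vecV) : coker (matA ^ n - 1))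

lemma gmap_apply (n : ℕ) (x) : gmap n x = ∑ i : Fin n, x (some i) •
    (Submodule.Quotient.mk ((matA ^ (i : ℕ)).mulVec vecV) : coker (matA ^ n - 1)) := by
  simp [gmap]

lemma gmap_none (n : ℕ) : gmap n (Pi.single none 1) = 0 := by
  rw [gmap_apply]; simp

lemma gmap_some (n : ℕ) (i : Fin n) : gmap n (Pi.single (some i) 1) =
    Submodule.Quotient.mk ((matA ^ (i : ℕ)).mulVec vecV) := by
  classical
  rw [gmap_apply, Finset.sum_eq_single i]
  · simp
  · intro j _ h
    simp [h]
  · simp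

lemma gmap_cast (m k : ℕ) : gmap (m+3) (Pi.single (some (k : Fin (m+3))) 1) =
    Submodule.Quotient.mk ((matA ^ k).mulVec vecV) := by
  rw [gmap_some, Fin.val_natCast, mk_mod]

lemma matA_rec (k : ℕ) (w : Fin 2 → ℤ) : (matA ^ (k+2)).mulVec w =
    3 • (matA ^ (k+1)).mulVec w - (matA ^ k).mulVec w := by
  rw [pow_add, matA_sq, mul_sub, mul_one, Matrix.sub_mulVec, mul_smul_comm, ← pow_succ,
    Matrix.smul_mulVec]

lemma cast_shift (m : ℕ) (i : Fin (m+3)) : ∃ k : ℕ, i = ((k+1 : ℕ) : Fin (m+3)) ∧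
    i + 1 = ((k+2 : ℕ) : Fin (m+3)) ∧ i - 1 = (k : Fin (m+3)) := by
  have h : i = ((i.val + m + 2 + 1 : ℕ) : Fin (m+3)) := by
    rw [show i.val + m + 2 + 1 = i.val + (m+3) by ring, Nat.cast_add, Fin.natCast_self, add_zero,
      Fin.cast_val_eq_self]
  refine ⟨i.val + m + 2, h, ?_, ?_⟩
  · conv_lhs => rw [h]
    push_cast; ring
  · conv_lhs => rw [h]
    rw [Nat.cast_succ, add_sub_cancel_right]

lemma gmap_col (m : ℕ) (i : Fin (m+3)) :
    gmap (m+3) ((lap (wheel (m+3))).mulVec (Pi.single (some i) 1)) = 0 := by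
  obtain ⟨k, h1, h2, h3⟩ := cast_shift m i
  rw [wheel_col, h2, h3, h1, LinearMap.map_sub, LinearMap.map_sub, LinearMap.map_sub, map_nsmul, gmap_cast, gmap_cast, gmap_cast,
    gmap_none, matA_rec, Submodule.Quotient.mk_sub, Submodule.Quotient.mk_smul]
  abel

lemma gmap_lap (m : ℕ) (x) : gmap (m+3) ((lap (wheel (m+3))).mulVec x) = 0 := by
  classical
  have h1 : (lap (wheel (m+3))).mulVec (fun _ => 1) = 0 :=
    lap_const _
  have hx : x = (x none) • (fun _ => (1:ℤ)) +
      ∑ i : Fin (m+3), (x (some i) - x none) • Pi.single (some i) (1:ℤ) := by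
    ext k
    cases k with
    | none => simp [Finset.sum_apply]
    | some j => simp [Finset.sum_apply, Pi.single_apply]
  rw [hx, Matrix.mulVec_add, Matrix.mulVec_smul, h1, smul_zero, zero_add, Matrix.mulVec_sum, map_sum]
  refine Finset.sum_eq_zero fun i _ => ?_
  rw [Matrix.mulVec_smul, map_smul, gmap_col, smul_zero]

/-- The class of `e_k - e_none`. -/
noncomputable def cc (m k : ℕ) : coker (lap (wheel (m+3))) :=
  Submodule.Quotient.mk (Pi.single (some (k : Fin (m+3))) 1 - Pi.single none 1)

lemma cc_rec (m k : ℕ) : cc m (k+2) = 3 • cc m (k+1) - cc m k := by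
  have h := coker_mk_mulVec (lap (wheel (m+3))) (Pi.single (some ((k+1 : ℕ) : Fin (m+3))) 1)
  rw [wheel_col] at h
  have e1 : ((k+1 : ℕ) : Fin (m+3)) + 1 = ((k+2 : ℕ) : Fin (m+3)) := by push_cast; ring
  have e2 : ((k+1 : ℕ) : Fin (m+3)) - 1 = (k : Fin (m+3)) := by push_cast; ring
  rw [e1, e2] at h
  unfold cc
  rw [← Submodule.Quotient.mk_smul, ← Submodule.Quotient.mk_sub, eq_comm, ← sub_eq_zero,
    ← Submodule.Quotient.mk_sub, ← h]
  congr 1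
  abel

lemma cc_n (m : ℕ) (k : ℕ) : cc m (k + (m+3)) = cc m k := by
  unfold cc
  rw [Nat.cast_add, Fin.natCast_self, add_zero]

/-- The inverse map before passing to the quotient. -/
noncomputable def hmap (m : ℕ) : (Fin 2 → ℤ) →ₗ[ℤ] coker (lap (wheel (m+3))) :=
  (LinearMap.proj 0 : (Fin 2 → ℤ) →ₗ[ℤ] ℤ).smulRight (cc m 0) -
  (LinearMap.proj 1 : (Fin 2 → ℤ) →ₗ[ℤ] ℤ).smulRight (cc m 1)

lemma hmap_apply (m : ℕ) (w) : hmap m w = w 0 • cc m 0 - w 1 • cc m 1 := by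
  simp [hmap]

lemma hmap_pow (m k : ℕ) : hmap m ((matA ^ k).mulVec vecV) = cc m k ∧
    hmap m ((matA ^ (k+1)).mulVec vecV) = cc m (k+1) := by
  induction k with
  | zero =>
    constructor
    · simp [hmap_apply, vecV]
    · simp [hmap_apply, vecV, matA, Matrix.mulVec, dotProduct]
  | succ k ih =>
    refine ⟨ih.2, ?_⟩
    rw [matA_rec, map_sub, map_nsmul, ih.1, ih.2, cc_rec]

lemma vec_decomp (w : Fin 2 → ℤ) :
    w = w 0 • (matA ^ 0).mulVec vecV - w 1 • (matA ^ 1).mulVec vecV := by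
  ext i
  fin_cases i <;> simp [matA, vecV, Matrix.mulVec, dotProduct]

lemma hmap_zero (m : ℕ) (w) : hmap m ((matA ^ (m+3) - 1).mulVec w) = 0 := by
  rw [vec_decomp w, Matrix.mulVec_sub, Matrix.mulVec_smul, Matrix.mulVec_smul, map_sub, map_smul,
    map_smul, Matrix.mulVec_mulVec, Matrix.mulVec_mulVec, sub_mul, sub_mul, one_mul, one_mul,
    (Commute.pow_pow_self matA (m+3) 0).eq, (Commute.pow_pow_self matA (m+3) 1).eq,
    ← pow_add, ← pow_add, Matrix.sub_mulVec, Matrix.sub_mulVec, map_sub, map_sub, (hmap_pow m _).1, (hmap_pow m _).1, (hmap_pow m _).1,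
    (hmap_pow m _).1, cc_n, cc_n]
  simp

/-- Map from the cokernel of the Laplacian. -/
noncomputable def gq (m : ℕ) : coker (lap (wheel (m+3))) →ₗ[ℤ] coker (matA ^ (m+3) - 1) :=
  Submodule.liftQ _ (gmap (m+3)) (coker_le_ker _ _ (gmap_lap m))

/-- Map into the cokernel of the Laplacian. -/
noncomputable def hq (m : ℕ) : coker (matA ^ (m+3) - 1) →ₗ[ℤ] coker (lap (wheel (m+3))) :=
  Submodule.liftQ _ (hmap m) (coker_le_ker _ _ (hmap_zero m))

lemma gq_mk (m : ℕ) (x) : gq m (Submodule.Quotient.mk x) = gmap (m+3) x := rfl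

lemma hq_mk (m : ℕ) (x) : hq m (Submodule.Quotient.mk x) = hmap m x := rfl

lemma gq_cc (m k : ℕ) : gq m (cc m k) = Submodule.Quotient.mk ((matA ^ k).mulVec vecV) := by
  rw [cc, gq_mk, map_sub, gmap_none, gmap_cast, sub_zero]

lemma gq_hq (m : ℕ) (z) : gq m (hq m z) = z := by
  obtain ⟨w, rfl⟩ := Submodule.Quotient.mk_surjective _ z
  rw [hq_mk, hmap_apply, map_sub, map_smul, map_smul, gq_cc, gq_cc, ← Submodule.Quotient.mk_smul,
    ← Submodule.Quotient.mk_smul, ← Submodule.Quotient.mk_sub, ← vec_decomp]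

lemma hq_gmap (m : ℕ) (x : Option (Fin (m+3)) → ℤ) (hx : ∑ i, x i = 0) :
    hq m (gmap (m+3) x) = Submodule.Quotient.mk x := by
  classical
  have hx' : x = ∑ i : Fin (m+3), x (some i) • (Pi.single (some i) 1 - Pi.single none (1:ℤ)) := by
    rw [Fintype.sum_option] at hx
    ext k
    cases k with
    | none => simp [Finset.sum_apply]; linarith
    | some j => simp [Finset.sum_apply, Pi.single_apply]
  rw [gmap_apply, map_sum]
  conv_rhs => rw [hx', ← Submodule.mkQ_apply, map_sum]
  refine Finset.sum_congr rfl fun i _ => ?_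
  rw [map_smul, map_smul, hq_mk, (hmap_pow m _).1, cc, Fin.cast_val_eq_self, Submodule.mkQ_apply]

lemma hq_torsion (m : ℕ) (z) : hq m z ∈ jac (wheel (m+3)) := by
  unfold jac
  rw [Submodule.mem_torsion_iff]
  refine ⟨⟨(matA ^ (m+2+1) - 1).det, mem_nonZeroDivisors_of_ne_zero (matA_det (m+2))⟩, ?_⟩
  obtain ⟨w, rfl⟩ := Submodule.Quotient.mk_surjective _ z
  rw [Submonoid.mk_smul, ← map_smul, ← Submodule.Quotient.mk_smul]
  have : (matA ^ (m+2+1) - 1).det • w =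
      (matA ^ (m+3) - 1).mulVec ((matA ^ (m+3) - 1).adjugate.mulVec w) := by
    rw [Matrix.mulVec_mulVec, Matrix.mul_adjugate, Matrix.smul_mulVec, Matrix.one_mulVec]
  rw [this, coker_mk_mulVec, map_zero]

lemma hq_gq (m : ℕ) (y) (hy : y ∈ jac (wheel (m+3))) : hq m (gq m y) = y := by
  unfold jac at hy
  rw [Submodule.mem_torsion_iff] at hy
  obtain ⟨⟨r, hr⟩, hy⟩ := hy
  obtain ⟨x, rfl⟩ := Submodule.Quotient.mk_surjective _ y
  rw [Submonoid.mk_smul, ← Submodule.Quotient.mk_smul] at hy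
  obtain ⟨u, hu⟩ := coker_mk_eq_zero _ _ hy
  have hs := lap_sum (wheel (m+3)) u
  rw [hu] at hs
  simp only [Pi.smul_apply, smul_eq_mul, ← Finset.mul_sum] at hs
  rw [gq_mk, hq_gmap]
  exact (mul_eq_zero.mp hs).resolve_left (nonZeroDivisors.ne_zero hr)

end helpers

theorem jac_wheel_iso_coker (n : ℕ) (hn : 3 ≤ n) :
    Nonempty (jac (wheel n) ≃+ coker ((!![0, 1; -1, 3] : Matrix (Fin 2) (Fin 2) ℤ) ^ n - 1)) := by
  obtain ⟨m, rfl⟩ := Nat.exists_eq_add_of_le' hn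
  exact ⟨{ toFun := fun y => gq m y.1
           invFun := fun z => ⟨hq m z, hq_torsion m z⟩
           left_inv := fun y => Subtype.ext (hq_gq m y.1 y.2)
           right_inv := fun z => gq_hq m z
           map_add' := fun a b => map_add (gq m) a.1 b.1 }⟩
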